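/- Let G be a bounded-degree Borel graph on the Ellentuck space [ℕ]^ℕ, let t ⊆ ℕ be a finite set and A ⊆ ℕ an infinite set with max t < min A. Then there exists an infinite set A' with t ⊆ A' ⊆ t ∪ A such that for all infinite B, C ⊆ A', if B and C are G-adjacent then the symmetric difference B △ C is finite. -/

import Mathlib

/-- The Ellentuck space `[ℕ]^ℕ`: the infinite subsets of `ℕ`, as a subtype of
`Set ℕ ≃ 2^ℕ`, with the induced Borel σ-algebra. -/
abbrev Ellentuck : Type := {A : Set ℕ // A.Infinite}

/-- A graph (symmetric irreflexive relation) has bounded degree if there is `d` such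
that every vertex has at most `d` neighbors. -/
def BddDegreeGraph {X : Type*} (G : SimpleGraph X) : Prop :=
  ∃ d : ℕ, ∀ x : X, {y | G.Adj x y}.Finite ∧ {y | G.Adj x y}.ncard ≤ d

/-- A Borel graph: the adjacency relation is Borel as a subset of `X × X`. -/
def BorelGraph {X : Type*} [MeasurableSpace X] (G : SimpleGraph X) : Prop :=
  MeasurableSet {p : X × X | G.Adj p.1 p.2}

/-- Every Borel set with uniformly bounded sections is covered by the graphs of finitely many
Borel functions. -/
theorem exists_measurable_graph_cover {X : Type*} [MeasurableSpace X] [StandardBorelSpace X]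
    [Nonempty X] (d : ℕ) (R : Set (X × X)) (hR : MeasurableSet R)
    (hd : ∀ x, {y | (x, y) ∈ R}.encard ≤ d) :
    ∃ F : Fin d → X → X, (∀ i, Measurable (F i)) ∧ ∀ x y, (x, y) ∈ R → ∃ i, y = F i x := by
  classical
  induction d generalizing R with
  | zero =>
    refine ⟨Fin.elim0, fun i => i.elim0, fun x y hxy => ?_⟩
    have h0 := hd x
    simp only [Nat.cast_zero, nonpos_iff_eq_zero, Set.encard_eq_zero] at h0
    exact absurd (show y ∈ {y | (x, y) ∈ R} from hxy) (by simp [h0])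
  | succ d ih =>
    obtain ⟨e, he⟩ := MeasureTheory.exists_measurableEmbedding_real X
    let S : Set (X × (Fin (d + 1) → X)) :=
      {p | (∀ i, (p.1, p.2 i) ∈ R) ∧ ∀ i j, i < j → e (p.2 i) < e (p.2 j)}
    have hS : MeasurableSet S := by
      have h1 : MeasurableSet {p : X × (Fin (d + 1) → X) | ∀ i, (p.1, p.2 i) ∈ R} := by
        rw [Set.ofPred_forall]
        refine MeasurableSet.iInter fun i => ?_
        exact (show Measurable fun p : X × (Fin (d + 1) → X) => (p.1, p.2 i) by fun_prop) hR
      have h2 : MeasurableSet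
          {p : X × (Fin (d + 1) → X) | ∀ i j, i < j → e (p.2 i) < e (p.2 j)} := by
        simp only [Set.ofPred_forall]
        refine MeasurableSet.iInter fun i => MeasurableSet.iInter fun j =>
          MeasurableSet.iInter fun _ => ?_
        exact measurableSet_lt (he.measurable.comp (by fun_prop))
          (he.measurable.comp (by fun_prop))
      exact h1.inter h2
    have hrange : ∀ p ∈ S, Set.range p.2 = {y | (p.1, y) ∈ R} := by
      rintro ⟨x, u⟩ ⟨hu, hlt⟩
      have hinj : Function.Injective u := by
        have : StrictMono (e ∘ u) := fun i j hij => hlt i j hij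
        exact this.injective.of_comp
      have hfin : {y | (x, y) ∈ R}.Finite :=
        Set.finite_of_encard_le_coe (hd x)
      refine hfin.eq_of_subset_of_encard_le' (Set.range_subset_iff.2 hu) ?_
      refine (hd x).trans ?_
      rw [← Set.image_univ, hinj.encard_image, Set.encard_univ]
      simp
    have hinj : Set.InjOn Prod.fst S := by
      rintro ⟨x, u⟩ hu ⟨x', v⟩ hv hxx
      obtain rfl : x = x' := hxx
      have h1 : StrictMono (e ∘ u) := fun i j hij => hu.2 i j hij
      have h2 : StrictMono (e ∘ v) := fun i j hij => hv.2 i j hij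
      have h3 : Set.range (e ∘ u) = Set.range (e ∘ v) := by
        rw [Set.range_comp, Set.range_comp, hrange _ hu, hrange _ hv]
      have h4 := (h1.range_inj h2).1 h3
      have h5 : u = v := funext fun i => he.injective (congrFun h4 i)
      rw [h5]
    have himage : ∀ T ⊆ S, MeasurableSet T → MeasurableSet (Prod.fst '' T) := fun T hT hTm =>
      hTm.image_of_measurable_injOn measurable_fst (hinj.mono hT)
    let D : Set X := Prod.fst '' S
    have hD : MeasurableSet D := himage S subset_rfl hS
    let f : X → X := fun x =>
      if h : x ∈ D then h.choose.2 0 else Classical.arbitrary X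
    have hfS : ∀ p ∈ S, f p.1 = p.2 0 := by
      intro p hp
      have h : p.1 ∈ D := ⟨p, hp, rfl⟩
      have heq : h.choose = p := hinj h.choose_spec.1 hp h.choose_spec.2
      simp only [f, dif_pos h, heq]
    have hf : Measurable f := by
      intro U hU
      have hpre : f ⁻¹' U = Prod.fst '' (S ∩ {p | p.2 0 ∈ U}) ∪
          (Dᶜ ∩ {_x | Classical.arbitrary X ∈ U}) := by
        ext x
        by_cases hx : x ∈ D
        · obtain ⟨p, hp, rfl⟩ := hx
          have hxD : p.1 ∈ D := ⟨p, hp, rfl⟩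
          simp only [Set.mem_preimage, hfS p hp, Set.mem_union, Set.mem_inter_iff,
            Set.mem_compl_iff, hxD, not_true_eq_false, false_and, or_false]
          constructor
          · exact fun h => ⟨p, ⟨hp, h⟩, rfl⟩
          · rintro ⟨q, ⟨hq, hqU⟩, hqp⟩
            rwa [← hinj hq hp hqp]
        · have hne : x ∉ Prod.fst '' (S ∩ {p | p.2 0 ∈ U}) := fun h =>
            hx (Set.image_mono Set.inter_subset_left h)
          have hfx : f x = Classical.arbitrary X := dif_neg hx
          simp only [Set.mem_preimage, hfx, Set.mem_union, hne, false_or, Set.mem_inter_iff,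
            Set.mem_compl_iff, hx, not_false_eq_true, true_and, Set.mem_ofPred_eq]
      rw [hpre]
      refine (himage _ Set.inter_subset_left (hS.inter ?_)).union
        (hD.compl.inter (MeasurableSet.const _))
      exact (show Measurable fun p : X × (Fin (d + 1) → X) => p.2 0 by fun_prop) hU
    have hgraph : MeasurableSet {p : X × X | p.2 = f p.1} :=
      measurableSet_eq_fun measurable_snd (hf.comp measurable_fst)
    obtain ⟨F, hF, hcov⟩ := ih (R \ {p | p.2 = f p.1}) (hR.diff hgraph) (by
      intro x
      have hsub : {y | (x, y) ∈ R \ {p | p.2 = f p.1}} ⊆ {y | (x, y) ∈ R} := fun y hy => hy.1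
      by_contra! hlt
      have hle : ((d + 1 : ℕ) : ℕ∞) ≤ {y | (x, y) ∈ R \ {p | p.2 = f p.1}}.encard := by
        push_cast
        exact Order.add_one_le_of_lt hlt
      have hfin : {y | (x, y) ∈ R}.Finite := Set.finite_of_encard_le_coe (hd x)
      have heq := hfin.eq_of_subset_of_encard_le' hsub ((hd x).trans hle)
      have hcard : hfin.toFinset.card = d + 1 := by
        have h1 : {y | (x, y) ∈ R}.encard = ((d + 1 : ℕ) : ℕ∞) :=
          le_antisymm (hd x) (hle.trans (Set.encard_le_encard hsub))
        rw [hfin.encard_eq_coe_toFinset_card] at h1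
        exact_mod_cast h1
      have hcard' : (hfin.toFinset.image e).card = d + 1 := by
        rw [Finset.card_image_of_injective _ he.injective, hcard]
      let o := (hfin.toFinset.image e).orderEmbOfFin hcard'
      have ho : ∀ i, ∃ y, (x, y) ∈ R ∧ e y = o i := fun i => by
        obtain ⟨y, hy, hyo⟩ := Finset.mem_image.1
          (Finset.orderEmbOfFin_mem (hfin.toFinset.image e) hcard' i)
        exact ⟨y, hfin.mem_toFinset.1 hy, hyo⟩
      choose u hu huo using ho
      have hxS : (x, u) ∈ S := ⟨hu, fun i j hij => by
        simpa only [huo] using o.strictMono hij⟩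
      have hmem : u 0 ∈ {y | (x, y) ∈ R \ {p | p.2 = f p.1}} := heq ▸ hu 0
      exact hmem.2 (hfS _ hxS).symm)
    refine ⟨Fin.cons f F, Fin.cases hf hF, fun x y hxy => ?_⟩
    by_cases h : y = f x
    · exact ⟨0, h⟩
    · obtain ⟨i, hi⟩ := hcov x y ⟨hxy, h⟩
      exact ⟨i.succ, hi⟩

theorem Set.Infinite.inter_Ioi {A : Set ℕ} (hA : A.Infinite) (n : ℕ) :
    (A ∩ Set.Ioi n).Infinite := by
  refine (hA.sdiff (Set.finite_Iic n)).mono fun x hx => ⟨hx.1, ?_⟩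
  simpa using hx.2

/-- Diagonal intersection: properties `P n` that are inherited by subsets and dense below `A`
can all be met, the `n`-th one past `n`, by a single infinite subset of `A`. -/
theorem exists_diagonal {A : Set ℕ} (hA : A.Infinite) (P : ℕ → Set ℕ → Prop)
    (hmono : ∀ n B C, C ⊆ B → P n B → P n C)
    (hdense : ∀ n, ∀ B ⊆ A, B.Infinite → ∃ C ⊆ B, C.Infinite ∧ P n C) :
    ∃ B ⊆ A, B.Infinite ∧ ∀ b ∈ B, P b (B ∩ Set.Ioi b) := by
  let Y := {B : Set ℕ // B ⊆ A ∧ B.Infinite}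
  have hstep : ∀ B : Y, ∃ C : Y, C.1 ⊆ B.1 ∩ Set.Ioi (sInf B.1) ∧ P (sInf B.1) C.1 := by
    rintro ⟨B, hBA, hB⟩
    obtain ⟨C, hCB, hC, hP⟩ := hdense (sInf B) (B ∩ Set.Ioi (sInf B))
      (Set.inter_subset_left.trans hBA) (hB.inter_Ioi _)
    exact ⟨⟨C, (hCB.trans Set.inter_subset_left).trans hBA, hC⟩, hCB, hP⟩
  choose next hnext hP using hstep
  let D : ℕ → Y := fun n => next^[n] ⟨A, subset_rfl, hA⟩
  have hD : ∀ n, D (n + 1) = next (D n) := fun n => Function.iterate_succ_apply' _ _ _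
  let a : ℕ → ℕ := fun n => sInf (D n).1
  have ha : ∀ n, a n ∈ (D n).1 := fun n => Nat.sInf_mem (D n).2.2.nonempty
  have hanti : Antitone fun n => (D n).1 := antitone_nat_of_succ_le fun n => by
    rw [hD]
    exact (hnext _).trans Set.inter_subset_left
  have hlt : StrictMono a := strictMono_nat_of_lt_succ fun n => by
    have h := ha (n + 1)
    rw [hD] at h
    exact (hnext _ h).2
  refine ⟨Set.range a, Set.range_subset_iff.2 fun n => (D n).2.1 (ha n),
    Set.infinite_range_of_injective hlt.injective, ?_⟩
  rintro _ ⟨n, rfl⟩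
  have hPn : P (a n) (D (n + 1)).1 := by
    rw [hD]
    exact hP (D n)
  refine hmono _ _ _ ?_ hPn
  rintro _ ⟨⟨m, rfl⟩, hm⟩
  exact hanti (Nat.succ_le_of_lt (hlt.lt_iff_lt.1 hm)) (ha m)

theorem exists_forall_finset_of_dense {ι : Type*} {A : Set ℕ} (Q : ι → Set ℕ → Prop)
    (hmono : ∀ i B C, C ⊆ B → Q i B → Q i C)
    (hdense : ∀ i, ∀ B ⊆ A, B.Infinite → ∃ C ⊆ B, C.Infinite ∧ Q i C) (F : Finset ι) :
    ∀ B ⊆ A, B.Infinite → ∃ C ⊆ B, C.Infinite ∧ ∀ i ∈ F, Q i C := by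
  classical
  induction F using Finset.induction_on with
  | empty => exact fun B _ hB => ⟨B, subset_rfl, hB, by simp⟩
  | insert i F _ ih =>
    intro B hBA hB
    obtain ⟨C, hCB, hC, hQ⟩ := ih B hBA hB
    obtain ⟨E, hEC, hE, hQi⟩ := hdense i C (hCB.trans hBA) hC
    refine ⟨E, hEC.trans hCB, hE, fun j hj => ?_⟩
    rcases Finset.mem_insert.1 hj with rfl | hj
    · exact hQi
    · exact hmono _ _ _ hEC (hQ j hj)

theorem exists_diagonal_finset {ι : Type*} {A : Set ℕ} (hA : A.Infinite) (F : ℕ → Finset ι)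
    (Q : ι → Set ℕ → Prop) (hmono : ∀ i B C, C ⊆ B → Q i B → Q i C)
    (hdense : ∀ i, ∀ B ⊆ A, B.Infinite → ∃ C ⊆ B, C.Infinite ∧ Q i C) :
    ∃ B ⊆ A, B.Infinite ∧ ∀ b ∈ B, ∀ i ∈ F b, Q i (B ∩ Set.Ioi b) :=
  exists_diagonal hA (fun n B => ∀ i ∈ F n, Q i B)
    (fun _ _ _ hCB h i hi => hmono _ _ _ hCB (h i hi))
    fun n => exists_forall_finset_of_dense Q hmono hdense (F n)

/-- `A` accepts `s` into `𝒳` if the whole cube of infinite sets `s ∪ X` with `X ⊆ A` lies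
in `𝒳`. -/
def Accepts (𝒳 : Set (Set ℕ)) (s : Finset ℕ) (A : Set ℕ) : Prop :=
  ∀ X ⊆ A, X.Infinite → ↑s ∪ X ∈ 𝒳

/-- Every cube contains a cube with the same stem that is contained in or disjoint from `𝒳`. -/
def CompletelyRamsey (𝒳 : Set (Set ℕ)) : Prop :=
  ∀ (s : Finset ℕ) (A : Set ℕ), A.Infinite →
    ∃ B ⊆ A, B.Infinite ∧ (Accepts 𝒳 s B ∨ Accepts 𝒳ᶜ s B)

theorem Accepts.mono {𝒳 : Set (Set ℕ)} {s : Finset ℕ} {A B : Set ℕ} (h : Accepts 𝒳 s A)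
    (hBA : B ⊆ A) : Accepts 𝒳 s B :=
  fun X hX => h X (hX.trans hBA)

theorem CompletelyRamsey.compl {𝒳 : Set (Set ℕ)} (h : CompletelyRamsey 𝒳) :
    CompletelyRamsey 𝒳ᶜ := fun s A hA => by
  obtain ⟨B, hBA, hB, hor⟩ := h s A hA
  exact ⟨B, hBA, hB, by rwa [compl_compl, or_comm]⟩

/-- For countably many completely Ramsey sets, membership in the `m`-th one is decided, below a
suitable infinite set, by initial segments extending beyond `m`. -/
theorem exists_forall_accepts_of_completelyRamsey (𝒳 : ℕ → Set (Set ℕ))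
    (h : ∀ n, CompletelyRamsey (𝒳 n)) {A : Set ℕ} (hA : A.Infinite) :
    ∃ B ⊆ A, B.Infinite ∧ ∀ b ∈ B, ∀ m ≤ b, ∀ s ⊆ Finset.range (b + 1),
      Accepts (𝒳 m) s (B ∩ Set.Ioi b) ∨ Accepts (𝒳 m)ᶜ s (B ∩ Set.Ioi b) := by
  obtain ⟨B, hBA, hB, hQ⟩ := exists_diagonal_finset hA
    (fun b => Finset.range (b + 1) ×ˢ (Finset.range (b + 1)).powerset)
    (fun i B => Accepts (𝒳 i.1) i.2 B ∨ Accepts (𝒳 i.1)ᶜ i.2 B)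
    (fun i B C hCB => Or.imp (fun h => h.mono hCB) (fun h => h.mono hCB))
    (fun i B _ hB => h i.1 i.2 B hB)
  refine ⟨B, hBA, hB, fun b hb m hm s hs => hQ b hb (m, s) ?_⟩
  simp only [Finset.mem_product, Finset.mem_range, Finset.mem_powerset]
  exact ⟨by omega, hs⟩

theorem exists_finset_initial (X : Set ℕ) (n : ℕ) :
    ∃ u : Finset ℕ, ↑u = X ∩ Set.Iic n :=
  ⟨((Set.finite_Iic n).inter_of_right X).toFinset, by simp⟩

theorem CompletelyRamsey.iUnion {𝒳 : ℕ → Set (Set ℕ)} (h : ∀ n, CompletelyRamsey (𝒳 n)) :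
    CompletelyRamsey (⋃ n, 𝒳 n) := by
  classical
  intro s₀ A hA
  set 𝒰 := ⋃ n, 𝒳 n with h𝒰
  obtain ⟨B₁, hB₁A, hB₁, hdec⟩ := exists_forall_accepts_of_completelyRamsey 𝒳 h hA
  obtain ⟨B, hBB₁, hB, hacc⟩ := exists_diagonal_finset hB₁
    (fun b => (Finset.range (b + 1)).powerset)
    (fun s B => Accepts 𝒰 s B ∨ ∀ C ⊆ B, C.Infinite → ¬ Accepts 𝒰 s C)
    (fun s B C hCB => Or.imp (fun h => h.mono hCB) (fun h E hE => h E (hE.trans hCB)))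
    (fun s B _ hB => by
      by_cases hex : ∃ C ⊆ B, C.Infinite ∧ Accepts 𝒰 s C
      · obtain ⟨C, hCB, hC, hs⟩ := hex
        exact ⟨C, hCB, hC, Or.inl hs⟩
      · exact ⟨B, subset_rfl, hB, Or.inr fun C hCB hC hs => hex ⟨C, hCB, hC, hs⟩⟩)
  let Rej : Finset ℕ → Prop := fun s => ∀ C ⊆ B, C.Infinite → ¬ Accepts 𝒰 s C
  by_cases hs₀ : Rej s₀
  swap
  · simp only [Rej, not_forall, not_not] at hs₀
    obtain ⟨C, hCB, hC, hs⟩ := hs₀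
    exact ⟨C, (hCB.trans hBB₁).trans hB₁A, hC, Or.inl hs⟩
  have hdense : ∀ s : Finset ℕ, ∀ C ⊆ B, C.Infinite →
      ∃ E ⊆ C, E.Infinite ∧ (Rej s → ∀ c ∈ E, Rej (insert c s)) := by
    intro s C hCB hC
    by_cases hs : Rej s
    swap
    · exact ⟨C, subset_rfl, hC, fun h => absurd h hs⟩
    by_cases hfin : {c ∈ C | ¬ Rej (insert c s)}.Finite
    · refine ⟨C \ {c ∈ C | ¬ Rej (insert c s)}, Set.sdiff_subset, hC.sdiff hfin, fun _ c hc => ?_⟩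
      by_contra hcon
      exact hc.2 ⟨hc.1, hcon⟩
    · exfalso
      set D := {c ∈ C | ¬ Rej (insert c s)} ∩ Set.Ioi (s.sup id) with hD
      have hDinf : D.Infinite := Set.Infinite.inter_Ioi hfin _
      refine hs D (fun c hc => hCB hc.1.1) hDinf fun X hXD hX => ?_
      have hmin := Nat.sInf_mem hX.nonempty
      set c := sInf X with hc
      obtain ⟨⟨hcC, hcR⟩, hcs⟩ := hXD hmin
      have hsub : insert c s ⊆ Finset.range (c + 1) := by
        intro i hi
        rcases Finset.mem_insert.1 hi with rfl | hi
        · simp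
        · have h1 : i ≤ s.sup id := Finset.le_sup (f := id) hi
          have h2 : s.sup id < c := hcs
          simp only [Finset.mem_range]
          omega
      have hcacc : Accepts 𝒰 (insert c s) (B ∩ Set.Ioi c) := by
        rcases hacc c (hCB hcC) _ (Finset.mem_powerset.2 hsub) with h1 | h1
        · exact h1
        · exfalso
          apply hcR
          intro E hEB hE hEacc
          exact h1 (E ∩ Set.Ioi c) (Set.inter_subset_inter_left _ hEB) (hE.inter_Ioi c)
            (hEacc.mono Set.inter_subset_left)
      have heq : (↑s ∪ X : Set ℕ) = ↑(insert c s) ∪ (X ∩ Set.Ioi c) := by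
        ext i
        simp only [Set.mem_union, Finset.mem_coe, Finset.mem_insert, Set.mem_inter_iff,
          Set.mem_Ioi]
        constructor
        · rintro (hi | hi)
          · exact Or.inl (Or.inr hi)
          · rcases (Nat.sInf_le hi : c ≤ i).eq_or_lt with h1 | h1
            · exact Or.inl (Or.inl h1.symm)
            · exact Or.inr ⟨hi, h1⟩
        · rintro ((rfl | hi) | hi)
          · exact Or.inr hmin
          · exact Or.inl hi
          · exact Or.inr hi.1
      rw [heq]
      exact hcacc _ (Set.inter_subset_inter_left _ fun i hi => hCB (hXD hi).1.1) (hX.inter_Ioi c)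
  obtain ⟨C, hCB, hC, hC₀⟩ := hdense s₀ B subset_rfl hB
  obtain ⟨E, hEC, hE, hEQ⟩ := exists_diagonal_finset (hC.inter_Ioi (s₀.sup id))
    (fun b => (Finset.range (b + 1)).powerset)
    (fun s E => Rej s → ∀ c ∈ E, Rej (insert c s))
    (fun s E E' hE' h hs c hc => h hs c (hE' hc))
    (fun s E hE => hdense s E ((hE.trans Set.inter_subset_left).trans hCB))
  have hEB : E ⊆ B := (hEC.trans Set.inter_subset_left).trans hCB
  have hs₀lt : ∀ i ∈ s₀, ∀ c ∈ E, i < c := fun i hi c hc =>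
    lt_of_le_of_lt (Finset.le_sup (f := id) hi) (hEC hc).2
  have hrej : ∀ u : Finset ℕ, ↑u ⊆ E → Rej (s₀ ∪ u) := by
    intro u
    induction u using Finset.induction_on_max with
    | empty => exact fun _ => by simpa using hs₀
    | insert c u hlt ih =>
      intro hu
      rw [Finset.coe_insert, Set.insert_subset_iff] at hu
      rw [Finset.union_insert]
      rcases u.eq_empty_or_nonempty with rfl | hne
      · simpa using hC₀ hs₀ c (hEC hu.1).1
      · have hmE : u.max' hne ∈ E := hu.2 (u.max'_mem hne)
        refine hEQ (u.max' hne) hmE (s₀ ∪ u) ?_ (ih hu.2) c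
          ⟨hu.1, hlt _ (u.max'_mem hne)⟩
        rw [Finset.mem_powerset]
        intro i hi
        rw [Finset.mem_range, Nat.lt_succ_iff]
        rcases Finset.mem_union.1 hi with hi | hi
        · exact (hs₀lt i hi _ hmE).le
        · exact u.le_max' i hi
  refine ⟨E, (hEB.trans hBB₁).trans hB₁A, hE, Or.inr fun X hXE hX hmem => ?_⟩
  obtain ⟨n, hn⟩ := Set.mem_iUnion.1 hmem
  obtain ⟨b, hbX, hnb⟩ := hX.exists_gt n
  obtain ⟨u, hu⟩ := exists_finset_initial X b
  have huX : ∀ i, i ∈ u ↔ i ∈ X ∧ i ≤ b := fun i => by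
    rw [← Finset.mem_coe, hu]
    rfl
  have hsub : s₀ ∪ u ⊆ Finset.range (b + 1) := by
    intro i hi
    rw [Finset.mem_range, Nat.lt_succ_iff]
    rcases Finset.mem_union.1 hi with hi | hi
    · exact (hs₀lt i hi _ (hXE hbX)).le
    · exact ((huX i).1 hi).2
  have heq : (↑s₀ ∪ X : Set ℕ) = ↑(s₀ ∪ u) ∪ (X ∩ Set.Ioi b) := by
    ext i
    have := le_or_gt i b
    simp only [Set.mem_union, Finset.mem_coe, Finset.mem_union, Set.mem_inter_iff, Set.mem_Ioi,
      huX]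
    tauto
  have hXB : X ∩ Set.Ioi b ⊆ B ∩ Set.Ioi b :=
    Set.inter_subset_inter_left _ (hXE.trans hEB)
  rcases hdec b (hBB₁ (hEB (hXE hbX))) n hnb.le _ hsub with h1 | h1
  · refine hrej u (fun i hi => hXE ((huX i).1 hi).1) (B ∩ Set.Ioi b) Set.inter_subset_left
      (hB.inter_Ioi b) fun Z hZ hZinf => ?_
    exact Set.mem_iUnion.2 ⟨n, h1 Z (hZ.trans (Set.inter_subset_inter_left _ hBB₁)) hZinf⟩
  · rw [heq] at hn
    exact h1 _ (hXB.trans (Set.inter_subset_inter_left _ hBB₁)) (hX.inter_Ioi b) hn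

/-- The σ-algebra of completely Ramsey sets. -/
@[reducible] def completelyRamseySpace : MeasurableSpace (Set ℕ) where
  MeasurableSet' := CompletelyRamsey
  measurableSet_empty := fun _ A hA => ⟨A, subset_rfl, hA, Or.inr fun _ _ _ h => h⟩
  measurableSet_compl := fun _ h => h.compl
  measurableSet_iUnion := fun _ h => CompletelyRamsey.iUnion h

/-- The Galvin–Prikry theorem: Borel sets are completely Ramsey. -/
theorem MeasurableSet.completelyRamsey {𝒳 : Set (Set ℕ)} (h : MeasurableSet 𝒳) :
    CompletelyRamsey 𝒳 := by
  have hle : (MeasurableSpace.pi : MeasurableSpace (ℕ → Prop)) ≤ completelyRamseySpace := by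
    refine iSup_le fun m => ?_
    rintro _ ⟨T, _, rfl⟩ s A hA
    refine ⟨A ∩ Set.Ioi m, Set.inter_subset_left, hA.inter_Ioi m, ?_⟩
    have hm : ∀ X ⊆ A ∩ Set.Ioi m, (↑s ∪ X : Set ℕ) m = (m ∈ s) := by
      intro X hX
      refine propext ⟨?_, fun h => Or.inl h⟩
      rintro (h | h)
      · exact h
      · exact absurd (hX h).2 (lt_irrefl m)
    by_cases hT : (m ∈ s) ∈ T
    · refine Or.inl fun X hX _ => ?_
      rw [← hm X hX] at hT
      exact hT
    · refine Or.inr fun X hX _ => ?_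
      rw [← hm X hX] at hT
      exact hT
  exact hle 𝒳 h

theorem exists_subset_diff_finite_of_completelyRamsey (𝒳 : ℕ → Set (Set ℕ))
    (h : ∀ n, CompletelyRamsey (𝒳 n)) (t : Finset ℕ) {A : Set ℕ} (hA : A.Infinite) :
    ∃ E ⊆ A, E.Infinite ∧ ∀ X ⊆ ↑t ∪ E, X.Infinite →
      {m | X ∈ 𝒳 m} ⊆ ↑t ∪ E → ({m | X ∈ 𝒳 m} \ X).Finite := by
  classical
  obtain ⟨B, hBA, hB, hdec⟩ := exists_forall_accepts_of_completelyRamsey 𝒳 h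
    (hA.inter_Ioi (t.sup id))
  obtain ⟨C, hCB, hC, hCQ⟩ := exists_diagonal_finset hB
    (fun b => (Finset.range (b + 1)).powerset)
    (fun s C => (∀ c ∈ C, Accepts (𝒳 c) s (B ∩ Set.Ioi c)) ∨
      ∀ c ∈ C, ¬ Accepts (𝒳 c) s (B ∩ Set.Ioi c))
    (fun s C D hDC => Or.imp (fun h c hc => h c (hDC hc)) (fun h c hc => h c (hDC hc)))
    (fun s C _ hC => by
      by_cases hfin : {c ∈ C | Accepts (𝒳 c) s (B ∩ Set.Ioi c)}.Finite
      · exact ⟨_, Set.sdiff_subset, hC.sdiff hfin, Or.inr fun c hc hcon => hc.2 ⟨hc.1, hcon⟩⟩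
      · exact ⟨_, Set.sep_subset _ _, hfin, Or.inl fun c hc => hc.2⟩)
  obtain ⟨E, hEC, hE, hgap⟩ := exists_diagonal hC
    (fun b E => ∃ d ∈ C, b < d ∧ E ⊆ Set.Ioi d)
    (fun b E D hDE ⟨d, hd, hbd, hsub⟩ => ⟨d, hd, hbd, hDE.trans hsub⟩)
    (fun b E hEC hE => by
      obtain ⟨d, hd, hbd⟩ := hE.exists_gt b
      exact ⟨E ∩ Set.Ioi d, Set.inter_subset_left, hE.inter_Ioi d, d, hEC hd, hbd,
        Set.inter_subset_right⟩)
  have htlt : ∀ c ∈ C, ∀ i ∈ t, i < c := fun c hc i hi =>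
    lt_of_le_of_lt (Finset.le_sup (f := id) hi) (hBA (hCB hc)).2
  refine ⟨E, ((hEC.trans hCB).trans hBA).trans Set.inter_subset_left, hE,
    fun X hXE hX hfX => ?_⟩
  obtain ⟨b₀, hb₀X, hb₀t⟩ := hX.exists_gt (t.sup id)
  have hnt : ∀ i, b₀ ≤ i → i ∉ t := fun i hi hit => by
    have : i ≤ t.sup id := Finset.le_sup (f := id) hit
    omega
  refine (Set.finite_Iic b₀).subset fun c hc => ?_
  by_contra hb₀c
  obtain ⟨hcf, hcX⟩ := hc
  rw [Set.mem_Iic, not_le] at hb₀c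
  have hcE : c ∈ E := (hfX hcf).resolve_left (hnt c hb₀c.le)
  obtain ⟨s, hs⟩ := exists_finset_initial X c
  have hsX : ∀ i, i ∈ s ↔ i ∈ X ∧ i ≤ c := fun i => by
    rw [← Finset.mem_coe, hs]
    rfl
  have hb₀s : b₀ ∈ s := (hsX b₀).2 ⟨hb₀X, hb₀c.le⟩
  set b := s.max' ⟨b₀, hb₀s⟩ with hb
  have hbs : b ∈ s := s.max'_mem _
  have hb₀b : b₀ ≤ b := s.le_max' _ hb₀s
  have hbX := (hsX b).1 hbs
  have hbE : b ∈ E := (hXE hbX.1).resolve_left (hnt b hb₀b)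
  have hbc : b < c := lt_of_le_of_ne hbX.2 fun h => hcX (h ▸ hbX.1)
  have hsb : s ⊆ Finset.range (b + 1) := fun i hi =>
    Finset.mem_range.2 (Nat.lt_succ_of_le (s.le_max' i hi))
  have heq : X = ↑s ∪ (X ∩ Set.Ioi c) := by
    ext i
    have := le_or_gt i c
    simp only [Set.mem_union, Finset.mem_coe, hsX, Set.mem_inter_iff, Set.mem_Ioi]
    tauto
  have htail : ∀ d ≤ c, X ∩ Set.Ioi c ⊆ B ∩ Set.Ioi d := by
    rintro d hd i ⟨hiX, hi⟩
    have hci : c < i := hi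
    exact ⟨hCB (hEC ((hXE hiX).resolve_left (hnt i (by omega)))), lt_of_le_of_lt hd hci⟩
  have hcacc : Accepts (𝒳 c) s (B ∩ Set.Ioi c) := by
    refine (hdec c (hCB (hEC hcE)) c le_rfl s
      (hsb.trans (Finset.range_mono (by omega)))).resolve_right fun hcon => ?_
    refine hcon _ (htail c le_rfl) (hX.inter_Ioi c) ?_
    rw [← heq]
    exact hcf
  obtain ⟨d, hdC, hbd, hEd⟩ := hgap b hbE
  have hdc : d < c := hEd ⟨hcE, hbc⟩
  have hdacc : Accepts (𝒳 d) s (B ∩ Set.Ioi d) := by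
    rcases hCQ b (hEC hbE) s (Finset.mem_powerset.2 hsb) with h1 | h1
    · exact h1 d ⟨hdC, hbd⟩
    · exact absurd hcacc (h1 c ⟨hEC hcE, hbc⟩)
  have hdf : X ∈ 𝒳 d := by
    have := hdacc _ (htail d hdc.le) (hX.inter_Ioi c)
    rwa [← heq] at this
  rcases hfX hdf with h1 | h1
  · exact lt_irrefl d (htlt d hdC d h1)
  · exact lt_irrefl d (hEd ⟨h1, hbd⟩)

theorem exists_subset_diff_finite_of_measurable {f : Ellentuck → Ellentuck} (hf : Measurable f)
    (t : Finset ℕ) {A : Set ℕ} (hA : A.Infinite) :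
    ∃ E ⊆ A, E.Infinite ∧ ∀ B : Ellentuck, B.1 ⊆ ↑t ∪ E → (f B).1 ⊆ ↑t ∪ E →
      ((f B).1 \ B.1).Finite := by
  have hm : ∀ m : ℕ, MeasurableSet {B : Ellentuck | m ∈ (f B).1} := fun m =>
    measurableSet_setOfPred.2 ((measurable_set_mem m).comp (measurable_subtype_coe.comp hf))
  choose 𝒳 h𝒳 hpre using hm
  have hiff : ∀ (B : Ellentuck) m, B.1 ∈ 𝒳 m ↔ m ∈ (f B).1 := fun B m =>
    Set.ext_iff.1 (hpre m) B
  obtain ⟨E, hEA, hE, hprop⟩ := exists_subset_diff_finite_of_completelyRamsey 𝒳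
    (fun n => (h𝒳 n).completelyRamsey) t hA
  refine ⟨E, hEA, hE, fun B hB hfB => ?_⟩
  have heq : {m | B.1 ∈ 𝒳 m} = (f B).1 := Set.ext fun m => hiff B m
  simpa only [heq, hfB, forall_const] using hprop B.1 hB B.2

theorem exists_subset_forall_diff_finite {ι : Type*} [Finite ι] {F : ι → Ellentuck → Ellentuck}
    (hF : ∀ i, Measurable (F i)) (t : Finset ℕ) {A : Set ℕ} (hA : A.Infinite) :
    ∃ E ⊆ A, E.Infinite ∧ ∀ i, ∀ B : Ellentuck, B.1 ⊆ ↑t ∪ E → (F i B).1 ⊆ ↑t ∪ E →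
      ((F i B).1 \ B.1).Finite := by
  cases nonempty_fintype ι
  obtain ⟨E, hEA, hE, h⟩ := exists_forall_finset_of_dense (A := A)
    (fun i E => ∀ B : Ellentuck, B.1 ⊆ ↑t ∪ E → (F i B).1 ⊆ ↑t ∪ E →
      ((F i B).1 \ B.1).Finite)
    (fun i E D hDE h B hB hFB => h B (hB.trans (Set.union_subset_union_right _ hDE))
      (hFB.trans (Set.union_subset_union_right _ hDE)))
    (fun i E _ hE => exists_subset_diff_finite_of_measurable (hF i) t hE)
    Finset.univ A subset_rfl hA
  exact ⟨E, hEA, hE, fun i => h i (Finset.mem_univ i)⟩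

theorem standardBorelSpace_ellentuck : StandardBorelSpace Ellentuck := by
  have : StandardBorelSpace (Set ℕ) := inferInstanceAs (StandardBorelSpace (ℕ → Prop))
  refine MeasurableSet.standardBorel ?_
  have heq : {A : Set ℕ | A.Infinite} = ⋂ n : ℕ, ⋃ m : ℕ, ⋃ _ : n < m, {A : Set ℕ | m ∈ A} := by
    ext A
    simp only [Set.mem_ofPred_eq, Set.mem_iInter, Set.mem_iUnion, exists_prop]
    refine ⟨fun h n => ?_, fun h => Set.infinite_of_forall_exists_gt fun n => ?_⟩
    · obtain ⟨m, hm, hnm⟩ := h.exists_gt n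
      exact ⟨m, hnm, hm⟩
    · obtain ⟨m, hnm, hm⟩ := h n
      exact ⟨m, hm, hnm⟩
  change MeasurableSet {A : Set ℕ | A.Infinite}
  rw [heq]
  exact MeasurableSet.iInter fun n => MeasurableSet.iUnion fun m => MeasurableSet.iUnion fun _ =>
    measurableSet_setOfPred.2 (measurable_set_mem m)

/-- For a bounded degree Borel graph `G` on the Ellentuck space, any cube `[t, A]`
contains `A'` such that `G` restricted to `[A']^ℕ` is contained in `𝔼₀`. -/
theorem graph_restriction_in_E0
    (G : SimpleGraph Ellentuck)
    (hGBorel : BorelGraph G) (hGdeg : BddDegreeGraph G)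
    (t : Finset ℕ) (A : Set ℕ) (hA : A.Infinite)
    (htA : ∀ i ∈ t, ∀ j ∈ A, i < j) :
    ∃ A' : Set ℕ, A'.Infinite ∧ ↑t ⊆ A' ∧ A' ⊆ ↑t ∪ A ∧
      ∀ B C : Ellentuck, B.1 ⊆ A' → C.1 ⊆ A' →
        G.Adj B C → (symmDiff B.1 C.1).Finite := by
  have := standardBorelSpace_ellentuck
  have : Nonempty Ellentuck := ⟨⟨A, hA⟩⟩
  obtain ⟨d, hd⟩ := hGdeg
  obtain ⟨F, hF, hcov⟩ := exists_measurable_graph_cover d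
    {p : Ellentuck × Ellentuck | G.Adj p.1 p.2} hGBorel fun x => by
      change {y | G.Adj x y}.encard ≤ d
      rw [← (hd x).1.cast_ncard_eq]
      exact_mod_cast (hd x).2
  obtain ⟨E, hEA, hE, h⟩ := exists_subset_forall_diff_finite hF t hA
  have hdiff : ∀ B C : Ellentuck, B.1 ⊆ ↑t ∪ E → C.1 ⊆ ↑t ∪ E → G.Adj B C →
      (C.1 \ B.1).Finite := by
    intro B C hB hC hBC
    obtain ⟨i, rfl⟩ := hcov B C hBC
    exact h i B hB hC
  refine ⟨↑t ∪ E, hE.mono Set.subset_union_right, Set.subset_union_left,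
    Set.union_subset_union_right _ hEA, fun B C hB hC hBC => ?_⟩
  exact (hdiff C B hC hB hBC.symm).union (hdiff B C hB hC hBC)
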